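/- arXiv:2402.14369 — 2 statements merged into one kernel-verified Lean document; each statement's English description precedes it below -/
import Mathlib

section
/- Let C_V, C_s > 0, let ρ ≥ max(24 λ_ex² C_V C_s / λ̲_V, 1/2 + √(1/4 + 6 λ_ex² C_V²)) and 0 < γ ≤ 1/(√m((1+α₀)C_V + λ̄_U) + 1). Fix (V^k, U^k, s^k, w^k) with ‖V^k‖_F² ≤ C_V, ‖V^{k+1}‖_F² ≤ C_V, ‖s^k‖₂² ≤ C_s, and w^k = (1/ρ) λ_ex (V^k)ᵀV^k s^k, and suppose one exADMM epoch is performed: V^{k+1} minimizes V ↦ L_ρ(V, U^k, s^k, w^k); U^{k+1} minimizes U ↦ ⟨U − U^k, ∇_U g(V^{k+1},U^k,s^k)⟩_F + (1/(2γ))‖U − U^k‖_F² + (ρ/2)‖(1/m)Uᵀ𝟙 − s^k + w^k‖₂²; s^{k+1} minimizes s ↦ L_ρ(V^{k+1}, U^{k+1}, s, w^k); and w^{k+1} = w^k + (1/m)(U^{k+1})ᵀ𝟙 − s^{k+1}. Then L_ρ(V^{k+1}, U^{k+1}, s^{k+1}, w^{k+1}) − L_ρ(V^k, U^k, s^k,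 w^k) ≤ −(1/2)‖U^{k+1} − U^k‖_F² − (λ̲_V/4)‖V^{k+1} − V^k‖_F² − (1/2)‖s^{k+1} − s^k‖₂² ≤ 0. -/
open Matrix Finset Filter Topology

noncomputable section

/-- Squared Frobenius norm of a real matrix. -/
def frobSq {a b : ℕ} (A : Matrix (Fin a) (Fin b) ℝ) : ℝ := ∑ i, ∑ j, (A i j) ^ 2

/-- Frobenius norm of a real matrix. -/
def frobNorm {a b : ℕ} (A : Matrix (Fin a) (Fin b) ℝ) : ℝ := Real.sqrt (frobSq A)

/-- Frobenius (trace) inner product of matrices. -/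
def frobInner {a b : ℕ} (A B : Matrix (Fin a) (Fin b) ℝ) : ℝ := ∑ i, ∑ j, A i j * B i j

/-- Squared Euclidean norm of a vector. -/
def vecSq {a : ℕ} (x : Fin a → ℝ) : ℝ := ∑ i, (x i) ^ 2

/-- Euclidean norm of a vector. -/
def vecNorm {a : ℕ} (x : Fin a → ℝ) : ℝ := Real.sqrt (vecSq x)

/-- Entrywise (Hadamard) product of matrices. -/
def hprod {a b : ℕ} (A B : Matrix (Fin a) (Fin b) ℝ) : Matrix (Fin a) (Fin b) ℝ :=
  Matrix.of fun i j => A i j * B i j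

/-- The iALS loss L(V,U). -/
def iALSLoss {m n d : ℕ} (R : Matrix (Fin m) (Fin n) ℝ) (α₀ : ℝ)
    (lamU : Fin m → ℝ) (lamV : Fin n → ℝ)
    (V : Matrix (Fin n) (Fin d) ℝ) (U : Matrix (Fin m) (Fin d) ℝ) : ℝ :=
  (1/2) * frobSq (hprod R (R - U * Vᵀ)) + (α₀/2) * frobSq (U * Vᵀ)
    + (1/2) * ∑ i, lamU i * vecSq (U i) + (1/2) * ∑ j, lamV j * vecSq (V j)

/-- g(V,U,s) = L(V,U) + (λ_ex/2)‖V s‖₂². -/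
def gFun {m n d : ℕ} (R : Matrix (Fin m) (Fin n) ℝ) (α₀ lamex : ℝ)
    (lamU : Fin m → ℝ) (lamV : Fin n → ℝ)
    (V : Matrix (Fin n) (Fin d) ℝ) (U : Matrix (Fin m) (Fin d) ℝ) (s : Fin d → ℝ) : ℝ :=
  iALSLoss R α₀ lamU lamV V U + (lamex/2) * vecSq (V.mulVec s)

/-- (1/m) Uᵀ 𝟙 : the average of the rows of U. -/
def avgRow {m d : ℕ} (U : Matrix (Fin m) (Fin d) ℝ) : Fin d → ℝ :=
  fun k => (1 / (m : ℝ)) * ∑ i, U i k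

/-- The augmented Lagrangian L_ρ(V,U,s,w). -/
def augL {m n d : ℕ} (R : Matrix (Fin m) (Fin n) ℝ) (α₀ lamex : ℝ)
    (lamU : Fin m → ℝ) (lamV : Fin n → ℝ) (ρ : ℝ)
    (V : Matrix (Fin n) (Fin d) ℝ) (U : Matrix (Fin m) (Fin d) ℝ) (s w : Fin d → ℝ) : ℝ :=
  gFun R α₀ lamex lamU lamV V U s + (ρ/2) * vecSq (avgRow U - s + w) - (ρ/2) * vecSq w

/-- Gradient of g with respect to V; the j-th row is
(Σ_i R_{ij} u_i u_iᵀ + α₀ UᵀU + λ_ex s sᵀ + λ_V^{(j)} I) v_j − Σ_i R_{ij} u_i. -/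
def gradV {m n d : ℕ} (R : Matrix (Fin m) (Fin n) ℝ) (α₀ lamex : ℝ)
    (lamV : Fin n → ℝ)
    (V : Matrix (Fin n) (Fin d) ℝ) (U : Matrix (Fin m) (Fin d) ℝ) (s : Fin d → ℝ) :
    Matrix (Fin n) (Fin d) ℝ :=
  Matrix.of fun j =>
    ((∑ i, R i j • vecMulVec (U i) (U i)) + α₀ • (Uᵀ * U)
        + lamex • vecMulVec s s + (lamV j) • (1 : Matrix (Fin d) (Fin d) ℝ)).mulVec (V j)
      - ∑ i, R i j • U i

/-- Gradient of g with respect to U; the i-th row is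
(Σ_j R_{ij} v_j v_jᵀ + α₀ VᵀV + λ_U^{(i)} I) u_i − Σ_j R_{ij} v_j (independent of s). -/
def gradU {m n d : ℕ} (R : Matrix (Fin m) (Fin n) ℝ) (α₀ : ℝ)
    (lamU : Fin m → ℝ)
    (V : Matrix (Fin n) (Fin d) ℝ) (U : Matrix (Fin m) (Fin d) ℝ) :
    Matrix (Fin m) (Fin d) ℝ :=
  Matrix.of fun i =>
    ((∑ j, R i j • vecMulVec (V j) (V j)) + α₀ • (Vᵀ * V)
        + (lamU i) • (1 : Matrix (Fin d) (Fin d) ℝ)).mulVec (U i)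
      - ∑ j, R i j • V j

/-- Gradient of g with respect to s: λ_ex VᵀV s (independent of U). -/
def gradS {n d : ℕ} (lamex : ℝ) (V : Matrix (Fin n) (Fin d) ℝ) (s : Fin d → ℝ) : Fin d → ℝ :=
  lamex • (Vᵀ * V).mulVec s

/-- Gradient of the augmented Lagrangian with respect to U. -/
def gradUL {m n d : ℕ} (R : Matrix (Fin m) (Fin n) ℝ) (α₀ : ℝ) (lamU : Fin m → ℝ) (ρ : ℝ)
    (V : Matrix (Fin n) (Fin d) ℝ) (U : Matrix (Fin m) (Fin d) ℝ) (s w : Fin d → ℝ) :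
    Matrix (Fin m) (Fin d) ℝ :=
  Matrix.of fun i => gradU R α₀ lamU V U i + (ρ / (m : ℝ)) • (avgRow U - s + w)

/-- Gradient of the augmented Lagrangian with respect to s:
λ_ex VᵀV s − ρ((1/m)Uᵀ𝟙 − s + w). -/
def gradSL {m n d : ℕ} (lamex ρ : ℝ)
    (V : Matrix (Fin n) (Fin d) ℝ) (U : Matrix (Fin m) (Fin d) ℝ) (s w : Fin d → ℝ) :
    Fin d → ℝ :=
  gradS lamex V s - ρ • (avgRow U - s + w)

/-- Gradient of the augmented Lagrangian with respect to w: ρ((1/m)Uᵀ𝟙 − s). -/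
def gradWL {m d : ℕ} (ρ : ℝ) (U : Matrix (Fin m) (Fin d) ℝ) (s : Fin d → ℝ) : Fin d → ℝ :=
  ρ • (avgRow U - s)

lemma vecSq_nonneg {a : ℕ} (x : Fin a → ℝ) : 0 ≤ vecSq x :=
  Finset.sum_nonneg fun _ _ => sq_nonneg _

lemma frobSq_nonneg {a b : ℕ} (A : Matrix (Fin a) (Fin b) ℝ) : 0 ≤ frobSq A :=
  Finset.sum_nonneg fun i _ => vecSq_nonneg (A i)

lemma vecSq_add_smul {a : ℕ} (x y : Fin a → ℝ) (t : ℝ) :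
    vecSq (x + t • y) = vecSq x + 2 * t * (x ⬝ᵥ y) + t ^ 2 * vecSq y := by
  simp only [vecSq, dotProduct, Finset.mul_sum, ← Finset.sum_add_distrib]
  refine Finset.sum_congr rfl fun i _ => ?_
  simp only [Pi.add_apply, Pi.smul_apply, smul_eq_mul]
  ring

lemma frobSq_add_smul {a b : ℕ} (A B : Matrix (Fin a) (Fin b) ℝ) (t : ℝ) :
    frobSq (A + t • B) = frobSq A + 2 * t * frobInner A B + t ^ 2 * frobSq B := by
  simp only [frobSq, frobInner, Finset.mul_sum, ← Finset.sum_add_distrib]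
  refine Finset.sum_congr rfl fun i _ => Finset.sum_congr rfl fun j _ => ?_
  simp only [Matrix.add_apply, Matrix.smul_apply, smul_eq_mul]
  ring

lemma vecSq_smul {a : ℕ} (c : ℝ) (x : Fin a → ℝ) : vecSq (c • x) = c ^ 2 * vecSq x := by
  simp only [vecSq, Finset.mul_sum, Pi.smul_apply, smul_eq_mul, mul_pow]

lemma vecSq_add_add_le {a : ℕ} (x y z : Fin a → ℝ) :
    vecSq (x + y + z) ≤ 3 * (vecSq x + vecSq y + vecSq z) := by
  simp only [vecSq, ← Finset.sum_add_distrib, Finset.mul_sum]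
  refine Finset.sum_le_sum fun i _ => ?_
  simp only [Pi.add_apply]
  nlinarith [sq_nonneg (x i - y i), sq_nonneg (x i - z i), sq_nonneg (y i - z i)]

lemma vecSq_mulVec_le {a b : ℕ} (A : Matrix (Fin a) (Fin b) ℝ) (x : Fin b → ℝ) :
    vecSq (A.mulVec x) ≤ frobSq A * vecSq x := by
  simp only [vecSq, frobSq, Matrix.mulVec, dotProduct, Finset.sum_mul]
  refine Finset.sum_le_sum fun i _ => ?_
  simpa only [Finset.sum_mul] using Finset.sum_mul_sq_le_sq_mul_sq Finset.univ (A i) x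

lemma frobSq_transpose {a b : ℕ} (A : Matrix (Fin a) (Fin b) ℝ) : frobSq Aᵀ = frobSq A :=
  Finset.sum_comm

lemma frobSq_mul_transpose_le {a b c : ℕ} (A : Matrix (Fin a) (Fin c) ℝ)
    (B : Matrix (Fin b) (Fin c) ℝ) : frobSq (A * Bᵀ) ≤ frobSq A * frobSq B := by
  have h : ∀ i, ∑ j, ((A * Bᵀ) i j) ^ 2 ≤ (∑ k, A i k ^ 2) * frobSq B := by
    intro i
    rw [frobSq, Finset.mul_sum]
    refine Finset.sum_le_sum fun j _ => ?_
    simpa only [Matrix.mul_apply, Matrix.transpose_apply] using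
      Finset.sum_mul_sq_le_sq_mul_sq Finset.univ (A i) (B j)
  calc frobSq (A * Bᵀ) ≤ ∑ i, (∑ k, A i k ^ 2) * frobSq B := Finset.sum_le_sum fun i _ => h i
    _ = frobSq A * frobSq B := by rw [← Finset.sum_mul]; rfl

lemma frobSq_hprod_le {a b : ℕ} {R : Matrix (Fin a) (Fin b) ℝ}
    (hR : ∀ i j, R i j = 0 ∨ R i j = 1) (A : Matrix (Fin a) (Fin b) ℝ) :
    frobSq (hprod R A) ≤ frobSq A := by
  refine Finset.sum_le_sum fun i _ => Finset.sum_le_sum fun j _ => ?_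
  rcases hR i j with h | h <;> simp [hprod, h, sq_nonneg]

/-- A quadratic polynomial minimized at `0` has no linear term. -/
lemma linear_coeff_eq_zero_of_isMin {b c : ℝ} (h : ∀ t : ℝ, 0 ≤ b * t + c * t ^ 2) : b = 0 := by
  have h0 : discrim c b 0 ≤ 0 := discrim_le_zero fun t => by nlinarith [h t]
  have : b ^ 2 ≤ 0 := by simpa [discrim] using h0
  exact pow_eq_zero_iff two_ne_zero |>.mp (le_antisymm this (sq_nonneg b))

lemma sum_mul_vecSq_add_smul {a b : ℕ} (c : Fin a → ℝ) (A B : Matrix (Fin a) (Fin b) ℝ) (t : ℝ) :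
    ∑ i, c i * vecSq ((A + t • B) i) = ∑ i, c i * vecSq (A i)
      + 2 * t * ∑ i, c i * (A i ⬝ᵥ B i) + t ^ 2 * ∑ i, c i * vecSq (B i) := by
  have h : ∀ i, vecSq ((A + t • B) i) = vecSq (A i) + 2 * t * (A i ⬝ᵥ B i) + t ^ 2 * vecSq (B i) :=
    fun i => vecSq_add_smul (A i) (B i) t
  simp only [h, Finset.mul_sum, ← Finset.sum_add_distrib]
  exact Finset.sum_congr rfl fun i _ => by ring

lemma iALSLoss_add_smul_left {m n d : ℕ} (R : Matrix (Fin m) (Fin n) ℝ) (α₀ : ℝ)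
    (lamU : Fin m → ℝ) (lamV : Fin n → ℝ) (V D : Matrix (Fin n) (Fin d) ℝ)
    (U : Matrix (Fin m) (Fin d) ℝ) (t : ℝ) :
    iALSLoss R α₀ lamU lamV (V + t • D) U = iALSLoss R α₀ lamU lamV V U
      + (-frobInner (hprod R (R - U * Vᵀ)) (hprod R (U * Dᵀ)) + α₀ * frobInner (U * Vᵀ) (U * Dᵀ)
          + ∑ j, lamV j * (V j ⬝ᵥ D j)) * t
      + ((1/2) * frobSq (hprod R (U * Dᵀ)) + (α₀/2) * frobSq (U * Dᵀ)
          + (1/2) * ∑ j, lamV j * vecSq (D j)) * t ^ 2 := by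
  have h1 : U * (V + t • D)ᵀ = U * Vᵀ + t • (U * Dᵀ) := by
    rw [Matrix.transpose_add, Matrix.transpose_smul, Matrix.mul_add, Matrix.mul_smul]
  have h2 : hprod R (R - (U * Vᵀ + t • (U * Dᵀ)))
      = hprod R (R - U * Vᵀ) + (-t) • hprod R (U * Dᵀ) := by
    ext i j
    simp only [hprod, Matrix.of_apply, Matrix.sub_apply, Matrix.add_apply, Matrix.smul_apply,
      smul_eq_mul]
    ring
  simp only [iALSLoss, h1, h2, frobSq_add_smul, sum_mul_vecSq_add_smul]
  ring

lemma iALSLoss_add_right {m n d : ℕ} {R : Matrix (Fin m) (Fin n) ℝ}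
    (hR : ∀ i j, R i j = 0 ∨ R i j = 1) (α₀ : ℝ)
    (lamU : Fin m → ℝ) (lamV : Fin n → ℝ) (V : Matrix (Fin n) (Fin d) ℝ)
    (U D : Matrix (Fin m) (Fin d) ℝ) :
    iALSLoss R α₀ lamU lamV V (U + D) = iALSLoss R α₀ lamU lamV V U
      + frobInner D (gradU R α₀ lamU V U)
      + ((1/2) * frobSq (hprod R (D * Vᵀ)) + (α₀/2) * frobSq (D * Vᵀ)
          + (1/2) * ∑ i, lamU i * vecSq (D i)) := by
  have h1 : (U + D) * Vᵀ = U * Vᵀ + (1 : ℝ) • (D * Vᵀ) := by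
    rw [Matrix.add_mul, one_smul]
  have h2 : hprod R (R - (U * Vᵀ + (1 : ℝ) • (D * Vᵀ)))
      = hprod R (R - U * Vᵀ) + (-1 : ℝ) • hprod R (D * Vᵀ) := by
    ext i j
    simp only [hprod, Matrix.of_apply, Matrix.sub_apply, Matrix.add_apply, Matrix.smul_apply,
      smul_eq_mul]
    ring
  have h3 : ∑ i, lamU i * vecSq ((U + D) i) = ∑ i, lamU i * vecSq (U i)
      + 2 * 1 * ∑ i, lamU i * (U i ⬝ᵥ D i) + 1 ^ 2 * ∑ i, lamU i * vecSq (D i) := by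
    rw [← sum_mul_vecSq_add_smul, one_smul]
  have h4 : frobInner D (gradU R α₀ lamU V U)
      = -frobInner (hprod R (R - U * Vᵀ)) (hprod R (D * Vᵀ)) + α₀ * frobInner (U * Vᵀ) (D * Vᵀ)
          + ∑ i, lamU i * (U i ⬝ᵥ D i) := by
    have hrow : ∀ i, ∑ k, D i k * gradU R α₀ lamU V U i k
        = D i ⬝ᵥ gradU R α₀ lamU V U i := fun i => rfl
    simp only [frobInner, hrow, Finset.mul_sum, ← Finset.sum_neg_distrib,
      ← Finset.sum_add_distrib]
    refine Finset.sum_congr rfl fun i _ => ?_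
    have e1 : ∀ j, (U * Vᵀ) i j = V j ⬝ᵥ U i := fun j => dotProduct_comm _ _
    have e2 : ∀ j, (D * Vᵀ) i j = V j ⬝ᵥ D i := fun j => dotProduct_comm _ _
    have e3 : (Vᵀ * V).mulVec (U i) = ∑ j, (V j ⬝ᵥ U i) • V j := by
      rw [← Matrix.mulVec_mulVec, Matrix.mulVec_transpose, Matrix.vecMul_eq_sum]
      rfl
    have e4 : gradU R α₀ lamU V U i
        = (∑ j, (R i j * (V j ⬝ᵥ U i)) • V j) + α₀ • (∑ j, (V j ⬝ᵥ U i) • V j)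
          + lamU i • U i - ∑ j, R i j • V j := by
      change ((∑ j, R i j • vecMulVec (V j) (V j)) + α₀ • (Vᵀ * V)
        + (lamU i) • (1 : Matrix (Fin d) (Fin d) ℝ)).mulVec (U i) - ∑ j, R i j • V j = _
      simp only [Matrix.add_mulVec, Matrix.smul_mulVec,
        Matrix.sum_mulVec, Matrix.vecMulVec_mulVec, Matrix.one_mulVec, e3]
      simp [mul_smul]
    rw [e4]
    simp only [dotProduct_sub, dotProduct_add, dotProduct_smul, dotProduct_sum, smul_eq_mul,
      hprod, Matrix.of_apply, Matrix.sub_apply, e1, e2]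
    simp only [dotProduct_comm (D i)]
    rw [add_sub_right_comm, Finset.mul_sum, ← Finset.sum_add_distrib, ← Finset.sum_sub_distrib]
    congr 1
    refine Finset.sum_congr rfl fun j _ => ?_
    rcases hR i j with h | h <;> rw [h] <;> ring
  simp only [iALSLoss, h1, h2, h3, h4, frobSq_add_smul]
  ring

lemma mul_frobSq_le_sum {a b : ℕ} {c : Fin a → ℝ} {l : ℝ} (h : ∀ i, l ≤ c i)
    (A : Matrix (Fin a) (Fin b) ℝ) : l * frobSq A ≤ ∑ i, c i * vecSq (A i) := by
  rw [frobSq, Finset.mul_sum]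
  exact Finset.sum_le_sum fun i _ => mul_le_mul_of_nonneg_right (h i) (vecSq_nonneg (A i))

lemma sum_le_mul_frobSq {a b : ℕ} {c : Fin a → ℝ} {l : ℝ} (h : ∀ i, c i ≤ l)
    (A : Matrix (Fin a) (Fin b) ℝ) : ∑ i, c i * vecSq (A i) ≤ l * frobSq A := by
  rw [frobSq, Finset.mul_sum]
  exact Finset.sum_le_sum fun i _ => mul_le_mul_of_nonneg_right (h i) (vecSq_nonneg (A i))

/-- Exact minimization in `V` decreases the augmented Lagrangian by strong convexity. -/
lemma augL_decrease_of_isMin_V {m n d : ℕ} {R : Matrix (Fin m) (Fin n) ℝ}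
    {α₀ lamex ρ : ℝ} (hα : 0 ≤ α₀) (hlamex : 0 ≤ lamex)
    {lamU : Fin m → ℝ} {lamV : Fin n → ℝ} {l : ℝ} (hl : ∀ j, l ≤ lamV j)
    {V V₁ : Matrix (Fin n) (Fin d) ℝ} {U : Matrix (Fin m) (Fin d) ℝ} {s w : Fin d → ℝ}
    (hmin : ∀ V' : Matrix (Fin n) (Fin d) ℝ,
      augL R α₀ lamex lamU lamV ρ V₁ U s w ≤ augL R α₀ lamex lamU lamV ρ V' U s w) :
    augL R α₀ lamex lamU lamV ρ V₁ U s w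
      ≤ augL R α₀ lamex lamU lamV ρ V U s w - (l/2) * frobSq (V₁ - V) := by
  obtain ⟨D, rfl⟩ : ∃ D, V = V₁ + (1 : ℝ) • D := ⟨V - V₁, by simp⟩
  have hexp : ∃ b, ∀ t : ℝ, augL R α₀ lamex lamU lamV ρ (V₁ + t • D) U s w
      = augL R α₀ lamex lamU lamV ρ V₁ U s w + (b * t
        + ((1/2) * frobSq (hprod R (U * Dᵀ)) + (α₀/2) * frobSq (U * Dᵀ)
          + (1/2) * ∑ j, lamV j * vecSq (D j) + (lamex/2) * vecSq (D.mulVec s)) * t ^ 2) := by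
    refine ⟨-frobInner (hprod R (R - U * V₁ᵀ)) (hprod R (U * Dᵀ))
      + α₀ * frobInner (U * V₁ᵀ) (U * Dᵀ) + ∑ j, lamV j * (V₁ j ⬝ᵥ D j)
      + lamex * (V₁.mulVec s ⬝ᵥ D.mulVec s), fun t => ?_⟩
    simp only [augL, gFun, iALSLoss_add_smul_left, Matrix.add_mulVec, Matrix.smul_mulVec,
      vecSq_add_smul]
    ring
  obtain ⟨b, hb⟩ := hexp
  have hb0 : b = 0 := linear_coeff_eq_zero_of_isMin fun t => by
    have := hmin (V₁ + t • D)
    rw [hb] at this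
    exact le_add_iff_nonneg_right _ |>.mp this
  have hD : frobSq (V₁ - (V₁ + (1 : ℝ) • D)) = frobSq D := by
    rw [one_smul, sub_add_cancel_left]
    simp [frobSq]
  rw [hb, hb0, hD]
  have h1 := mul_frobSq_le_sum hl D
  have h2 := frobSq_nonneg (hprod R (U * Dᵀ))
  have h3 := mul_nonneg hα (frobSq_nonneg (U * Dᵀ))
  have h4 := mul_nonneg hlamex (vecSq_nonneg (D.mulVec s))
  linarith

/-- Descent lemma for the smooth part `g` as a function of `U`. -/
lemma gFun_le_of_smooth_U {m n d : ℕ} {R : Matrix (Fin m) (Fin n) ℝ}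
    (hR : ∀ i j, R i j = 0 ∨ R i j = 1) {α₀ : ℝ} (lamex : ℝ) (hα : 0 ≤ α₀)
    {lamU : Fin m → ℝ} (lamV : Fin n → ℝ) {l C : ℝ} (hl : ∀ i, lamU i ≤ l)
    {V : Matrix (Fin n) (Fin d) ℝ} (hV : frobSq V ≤ C) (U U₁ : Matrix (Fin m) (Fin d) ℝ)
    (s : Fin d → ℝ) :
    gFun R α₀ lamex lamU lamV V U₁ s ≤ gFun R α₀ lamex lamU lamV V U s
      + frobInner (U₁ - U) (gradU R α₀ lamU V U)
      + ((1 + α₀) * C + l) / 2 * frobSq (U₁ - U) := by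
  obtain ⟨D, rfl⟩ : ∃ D, U₁ = U + D := ⟨U₁ - U, by simp⟩
  rw [add_sub_cancel_left]
  simp only [gFun, iALSLoss_add_right hR]
  have h1 := sum_le_mul_frobSq hl D
  have h2 := frobSq_hprod_le hR (D * Vᵀ)
  have h3 : frobSq (D * Vᵀ) ≤ C * frobSq D :=
    (frobSq_mul_transpose_le D V).trans (by nlinarith [frobSq_nonneg D])
  have h4 := mul_le_mul_of_nonneg_left h3 hα
  linarith

lemma augL_add_smul_s {m n d : ℕ} (R : Matrix (Fin m) (Fin n) ℝ) (α₀ lamex ρ : ℝ)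
    (lamU : Fin m → ℝ) (lamV : Fin n → ℝ) (V : Matrix (Fin n) (Fin d) ℝ)
    (U : Matrix (Fin m) (Fin d) ℝ) (s w e : Fin d → ℝ) (t : ℝ) :
    augL R α₀ lamex lamU lamV ρ V U (s + t • e) w = augL R α₀ lamex lamU lamV ρ V U s w
      + ((gradSL lamex ρ V U s w ⬝ᵥ e) * t
        + ((lamex/2) * vecSq (V.mulVec e) + (ρ/2) * vecSq e) * t ^ 2) := by
  have h1 : avgRow U - (s + t • e) + w = (avgRow U - s + w) + (-t) • e := by
    rw [neg_smul]; abel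
  have h2 : gradSL lamex ρ V U s w ⬝ᵥ e
      = lamex * (V.mulVec s ⬝ᵥ V.mulVec e) - ρ * ((avgRow U - s + w) ⬝ᵥ e) := by
    rw [gradSL, gradS, sub_dotProduct, smul_dotProduct, smul_dotProduct, ← Matrix.mulVec_mulVec,
      Matrix.mulVec_transpose, ← Matrix.dotProduct_mulVec]
    rfl
  rw [h2]
  simp only [augL, gFun, h1, Matrix.mulVec_add, Matrix.mulVec_smul, vecSq_add_smul]
  ring

/-- The first-order optimality condition for a minimizer in `s`. -/
lemma gradSL_eq_zero_of_isMin {m n d : ℕ} {R : Matrix (Fin m) (Fin n) ℝ} {α₀ lamex ρ : ℝ}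
    {lamU : Fin m → ℝ} {lamV : Fin n → ℝ} {V : Matrix (Fin n) (Fin d) ℝ}
    {U : Matrix (Fin m) (Fin d) ℝ} {s₁ w : Fin d → ℝ}
    (hmin : ∀ s' : Fin d → ℝ,
      augL R α₀ lamex lamU lamV ρ V U s₁ w ≤ augL R α₀ lamex lamU lamV ρ V U s' w) :
    gradSL lamex ρ V U s₁ w = 0 := by
  rw [← dotProduct_self_eq_zero]
  refine linear_coeff_eq_zero_of_isMin
    (c := (lamex/2) * vecSq (V.mulVec (gradSL lamex ρ V U s₁ w))
      + (ρ/2) * vecSq (gradSL lamex ρ V U s₁ w)) fun t => ?_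
  have := hmin (s₁ + t • gradSL lamex ρ V U s₁ w)
  rw [augL_add_smul_s] at this
  exact le_add_iff_nonneg_right _ |>.mp this

/-- Exact minimization in `s` decreases the augmented Lagrangian by strong convexity. -/
lemma augL_decrease_of_isMin_s {m n d : ℕ} {R : Matrix (Fin m) (Fin n) ℝ} {α₀ lamex ρ : ℝ}
    (hlamex : 0 ≤ lamex)
    {lamU : Fin m → ℝ} {lamV : Fin n → ℝ} {V : Matrix (Fin n) (Fin d) ℝ}
    {U : Matrix (Fin m) (Fin d) ℝ} {s s₁ w : Fin d → ℝ}
    (hmin : ∀ s' : Fin d → ℝ,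
      augL R α₀ lamex lamU lamV ρ V U s₁ w ≤ augL R α₀ lamex lamU lamV ρ V U s' w) :
    augL R α₀ lamex lamU lamV ρ V U s₁ w
      ≤ augL R α₀ lamex lamU lamV ρ V U s w - (ρ/2) * vecSq (s₁ - s) := by
  obtain ⟨e, rfl⟩ : ∃ e, s = s₁ + (1 : ℝ) • e := ⟨s - s₁, by simp⟩
  have he : vecSq (s₁ - (s₁ + (1 : ℝ) • e)) = vecSq e := by
    rw [one_smul, sub_add_cancel_left]
    simp [vecSq]
  rw [augL_add_smul_s, gradSL_eq_zero_of_isMin hmin, he, zero_dotProduct]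
  have := mul_nonneg hlamex (vecSq_nonneg (V.mulVec e))
  linarith

/-- The dual update increases the augmented Lagrangian by `ρ‖w₁ - w‖²`. -/
lemma augL_dual_update {m n d : ℕ} (R : Matrix (Fin m) (Fin n) ℝ) (α₀ lamex ρ : ℝ)
    (lamU : Fin m → ℝ) (lamV : Fin n → ℝ) (V : Matrix (Fin n) (Fin d) ℝ)
    (U : Matrix (Fin m) (Fin d) ℝ) {s w w₁ : Fin d → ℝ} (hw : w₁ = w + avgRow U - s) :
    augL R α₀ lamex lamU lamV ρ V U s w₁
      = augL R α₀ lamex lamU lamV ρ V U s w + ρ * vecSq (w₁ - w) := by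
  have h1 : avgRow U - s + w = w₁ + (0 : ℝ) • (w₁ - w) := by rw [hw, zero_smul]; abel
  have h2 : avgRow U - s + w₁ = w₁ + (1 : ℝ) • (w₁ - w) := by rw [hw, one_smul]; abel
  have h3 : vecSq w = vecSq (w₁ + (-1 : ℝ) • (w₁ - w)) := by congr 1; simp
  simp only [augL, h1, h2, h3, vecSq_add_smul]
  ring

/-- The map `(V, s) ↦ VᵀV s` is Lipschitz on bounded sets. -/
lemma vecSq_gram_sub_le {n d : ℕ} {V V₁ : Matrix (Fin n) (Fin d) ℝ} {s : Fin d → ℝ} {C Cs : ℝ}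
    (hV : frobSq V ≤ C) (hV₁ : frobSq V₁ ≤ C) (hs : vecSq s ≤ Cs) (s₁ : Fin d → ℝ) :
    vecSq ((V₁ᵀ * V₁).mulVec s₁ - (Vᵀ * V).mulVec s)
      ≤ 3 * (C ^ 2 * vecSq (s₁ - s) + 2 * (C * Cs * frobSq (V₁ - V))) := by
  have key : (V₁ᵀ * V₁).mulVec s₁ - (Vᵀ * V).mulVec s
      = V₁ᵀ.mulVec (V₁.mulVec (s₁ - s)) + V₁ᵀ.mulVec ((V₁ - V).mulVec s)
        + (V₁ - V)ᵀ.mulVec (V.mulVec s) := by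
    simp only [Matrix.mulVec_sub, Matrix.sub_mulVec, Matrix.transpose_sub, Matrix.mulVec_mulVec,
      Matrix.sub_mul]
    abel
  have hC : 0 ≤ C := (frobSq_nonneg V).trans hV
  have bound : ∀ (A B : Matrix (Fin n) (Fin d) ℝ) (x : Fin d → ℝ),
      vecSq (Aᵀ.mulVec (B.mulVec x)) ≤ frobSq A * (frobSq B * vecSq x) := fun A B x =>
    (vecSq_mulVec_le _ _).trans <| by
      rw [frobSq_transpose]
      exact mul_le_mul_of_nonneg_left (vecSq_mulVec_le _ _) (frobSq_nonneg A)
  have hD := frobSq_nonneg (V₁ - V)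
  have b1 : vecSq (V₁ᵀ.mulVec (V₁.mulVec (s₁ - s))) ≤ C * (C * vecSq (s₁ - s)) := by
    refine (bound _ _ _).trans ?_
    have := vecSq_nonneg (s₁ - s)
    have := frobSq_nonneg V₁
    gcongr
  have b2 : vecSq (V₁ᵀ.mulVec ((V₁ - V).mulVec s)) ≤ C * (frobSq (V₁ - V) * Cs) := by
    refine (bound _ _ _).trans ?_
    have := vecSq_nonneg s
    gcongr
  have b3 : vecSq ((V₁ - V)ᵀ.mulVec (V.mulVec s)) ≤ frobSq (V₁ - V) * (C * Cs) := by
    refine (bound _ _ _).trans ?_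
    have := vecSq_nonneg s
    gcongr
  rw [key]
  refine (vecSq_add_add_le _ _ _).trans ?_
  linarith

/-- one exADMM epoch decreases the augmented Lagrangian. -/
theorem epoch_decrease {m n d : ℕ} (hm : 1 ≤ m) (hn : 1 ≤ n) (hd : 1 ≤ d)
    (R : Matrix (Fin m) (Fin n) ℝ) (hR : ∀ i j, R i j = 0 ∨ R i j = 1)
    (α₀ lamex ρ γ : ℝ) (hα : 0 < α₀) (hlamex : 0 < lamex) (hρ0 : 0 < ρ) (hγ0 : 0 < γ)
    (lamU : Fin m → ℝ) (lamV : Fin n → ℝ)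
    (hlamU : ∀ i, 0 < lamU i) (hlamV : ∀ j, 0 < lamV j)
    (lamUbar lamVlow : ℝ)
    (hUbar : IsGreatest (Set.range lamU) lamUbar)
    (hVlow : IsLeast (Set.range lamV) lamVlow)
    (CV Cs : ℝ) (hCV : 0 < CV) (hCs : 0 < Cs)
    (hρ : ρ ≥ max (24 * lamex ^ 2 * CV * Cs / lamVlow)
        (1/2 + Real.sqrt (1/4 + 6 * lamex ^ 2 * CV ^ 2)))
    (hγ : γ ≤ 1 / (Real.sqrt m * ((1 + α₀) * CV + lamUbar) + 1))
    (Vk Vk1 : Matrix (Fin n) (Fin d) ℝ) (Uk Uk1 : Matrix (Fin m) (Fin d) ℝ)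
    (sk sk1 wk wk1 : Fin d → ℝ)
    (hVkb : frobSq Vk ≤ CV) (hVk1b : frobSq Vk1 ≤ CV) (hskb : vecSq sk ≤ Cs)
    (hwk : wk = (1/ρ) • gradS lamex Vk sk)
    (hVmin : ∀ V' : Matrix (Fin n) (Fin d) ℝ,
      augL R α₀ lamex lamU lamV ρ Vk1 Uk sk wk
        ≤ augL R α₀ lamex lamU lamV ρ V' Uk sk wk)
    (hUmin : ∀ U' : Matrix (Fin m) (Fin d) ℝ,
      frobInner (Uk1 - Uk) (gradU R α₀ lamU Vk1 Uk)
          + (1/(2*γ)) * frobSq (Uk1 - Uk)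
          + (ρ/2) * vecSq (avgRow Uk1 - sk + wk)
        ≤ frobInner (U' - Uk) (gradU R α₀ lamU Vk1 Uk)
          + (1/(2*γ)) * frobSq (U' - Uk)
          + (ρ/2) * vecSq (avgRow U' - sk + wk))
    (hsmin : ∀ s' : Fin d → ℝ,
      augL R α₀ lamex lamU lamV ρ Vk1 Uk1 sk1 wk
        ≤ augL R α₀ lamex lamU lamV ρ Vk1 Uk1 s' wk)
    (hwk1 : wk1 = wk + avgRow Uk1 - sk1) :
    augL R α₀ lamex lamU lamV ρ Vk1 Uk1 sk1 wk1
        - augL R α₀ lamex lamU lamV ρ Vk Uk sk wk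
      ≤ -(1/2) * frobSq (Uk1 - Uk) - (lamVlow/4) * frobSq (Vk1 - Vk)
        - (1/2) * vecSq (sk1 - sk)
    ∧ -(1/2) * frobSq (Uk1 - Uk) - (lamVlow/4) * frobSq (Vk1 - Vk)
        - (1/2) * vecSq (sk1 - sk) ≤ 0 := by
  have hlow : ∀ j, lamVlow ≤ lamV j := fun j => hVlow.2 ⟨j, rfl⟩
  have hbar : ∀ i, lamU i ≤ lamUbar := fun i => hUbar.2 ⟨i, rfl⟩
  have hlow0 : 0 < lamVlow := by
    obtain ⟨j, hj⟩ := hVlow.1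
    exact hj ▸ hlamV j
  have hbar0 : 0 < lamUbar := by
    obtain ⟨i, hi⟩ := hUbar.1
    exact hi ▸ hlamU i
  have hdU := frobSq_nonneg (Uk1 - Uk)
  have hdV := frobSq_nonneg (Vk1 - Vk)
  have hds := vecSq_nonneg (sk1 - sk)
  have stepV := augL_decrease_of_isMin_V hα.le hlamex.le hlow (V := Vk) hVmin
  have steps := augL_decrease_of_isMin_s hlamex.le (s := sk) hsmin
  have stepw := augL_dual_update R α₀ lamex ρ lamU lamV Vk1 Uk1 hwk1
  have stepU : augL R α₀ lamex lamU lamV ρ Vk1 Uk1 sk wk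
      ≤ augL R α₀ lamex lamU lamV ρ Vk1 Uk sk wk - (1/2) * frobSq (Uk1 - Uk) := by
    have hmin := hUmin Uk
    have hself : frobInner (Uk - Uk) (gradU R α₀ lamU Vk1 Uk) = 0 ∧ frobSq (Uk - Uk) = 0 := by
      simp [frobInner, frobSq]
    rw [hself.1, hself.2] at hmin
    have hsmooth := gFun_le_of_smooth_U hR lamex hα.le lamV hbar hVk1b Uk Uk1 sk
    have hL : 0 < (1 + α₀) * CV + lamUbar := by positivity
    have hsqrt : 1 ≤ Real.sqrt m := Real.one_le_sqrt.mpr (by exact_mod_cast hm)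
    have hinv : (1 + α₀) * CV + lamUbar + 1 ≤ 1 / γ := by
      have h := one_div_le_one_div_of_le hγ0 hγ
      rw [one_div_one_div] at h
      nlinarith
    have hγ2 : 1 / (2 * γ) = (1 / γ) / 2 := by field_simp
    rw [hγ2] at hmin
    have := mul_le_mul_of_nonneg_right hinv hdU
    simp only [augL]
    linarith
  have hdual : ρ • (wk1 - wk)
      = lamex • ((Vk1ᵀ * Vk1).mulVec sk1 - (Vkᵀ * Vk).mulVec sk) := by
    have h := gradSL_eq_zero_of_isMin hsmin
    rw [gradSL, sub_eq_zero] at h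
    have h1 : wk1 = avgRow Uk1 - sk1 + wk := by rw [hwk1]; abel
    have h2 : ρ • wk = gradS lamex Vk sk := by
      rw [hwk, smul_smul, mul_one_div_cancel hρ0.ne', one_smul]
    rw [smul_sub, h1, ← h, h2, smul_sub]
    rfl
  have hdualSq : ρ ^ 2 * vecSq (wk1 - wk)
      = lamex ^ 2 * vecSq ((Vk1ᵀ * Vk1).mulVec sk1 - (Vkᵀ * Vk).mulVec sk) := by
    rw [← vecSq_smul, hdual, vecSq_smul]
  have hgram := mul_le_mul_of_nonneg_left
    (vecSq_gram_sub_le hVkb hVk1b hskb sk1) (sq_nonneg lamex)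
  have hρ1 : 24 * lamex ^ 2 * CV * Cs ≤ ρ * lamVlow :=
    (div_le_iff₀ hlow0).mp ((le_max_left _ _).trans hρ)
  have hρ2 : 6 * lamex ^ 2 * CV ^ 2 ≤ ρ ^ 2 - ρ := by
    have h := (le_max_right _ _).trans hρ
    have h0 : Real.sqrt (1/4 + 6 * lamex ^ 2 * CV ^ 2) ≤ ρ - 1/2 := by linarith
    have h1 : 1/4 + 6 * lamex ^ 2 * CV ^ 2 ≤ (ρ - 1/2) ^ 2 := (Real.sqrt_le_iff.mp h0).2
    linarith
  have hw : ρ * vecSq (wk1 - wk)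
      ≤ (lamVlow/4) * frobSq (Vk1 - Vk) + ((ρ - 1)/2) * vecSq (sk1 - sk) := by
    refine le_of_mul_le_mul_left ?_ hρ0
    have a1 := mul_le_mul_of_nonneg_right hρ1 hdV
    have a2 := mul_le_mul_of_nonneg_right hρ2 hds
    linarith
  refine ⟨by linarith, ?_⟩
  have := mul_nonneg hlow0.le hdV
  linarith
end
end

section
/- Let C_U, C_s > 0 and fix (V^k, U^k, s^k, w^k) with ‖U^k‖_F² ≤ C_U and ‖s^k‖₂² ≤ C_s. If V^{k+1} minimizes V ↦ L_ρ(V, U^k, s^k, w^k), then the gradient of the augmented Lagrangian with respect to V at the current iterate satisfies ‖∇_V L_ρ(V^k, U^k, s^k, w^k)‖_F ≤ √n · ((1+α₀) C_U + λ_ex C_s + λ̄_V) · ‖V^{k+1} − V^k‖_F. -/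
open Matrix Finset Filter Topology

noncomputable section

/-- The part of the loss that depends on the single row `v` of `V`: here `r` is the matching column
of `R` and `l` the regularization weight of that row. -/
def rowLoss {m d : ℕ} (r : Fin m → ℝ) (α₀ lamex l : ℝ) (U : Matrix (Fin m) (Fin d) ℝ)
    (s v : Fin d → ℝ) : ℝ :=
  (1/2) * ∑ i, r i * (1 - U i ⬝ᵥ v) ^ 2 + (α₀/2) * ∑ i, (U i ⬝ᵥ v) ^ 2
    + (l/2) * (v ⬝ᵥ v) + (lamex/2) * (s ⬝ᵥ v) ^ 2

/-- The Hessian of `rowLoss` applied to a vector. -/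
def rowHess {m d : ℕ} (r : Fin m → ℝ) (α₀ lamex l : ℝ) (U : Matrix (Fin m) (Fin d) ℝ)
    (s v : Fin d → ℝ) : Fin d → ℝ :=
  ∑ i, ((r i + α₀) * (U i ⬝ᵥ v)) • U i + (lamex * (s ⬝ᵥ v)) • s + l • v

lemma vecSq_eq_dotProduct {a : ℕ} (x : Fin a → ℝ) : vecSq x = x ⬝ᵥ x := by
  simp [vecSq, dotProduct, sq]

lemma vecNorm_sq {a : ℕ} (x : Fin a → ℝ) : vecNorm x ^ 2 = vecSq x :=
  Real.sq_sqrt (vecSq_nonneg x)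

lemma vecNorm_eq_norm {a : ℕ} (x : Fin a → ℝ) : vecNorm x = ‖WithLp.toLp 2 x‖ := by
  simp [vecNorm, vecSq, EuclideanSpace.norm_eq]

lemma frobSq_eq_sum_vecSq {a b : ℕ} (A : Matrix (Fin a) (Fin b) ℝ) :
    frobSq A = ∑ i, vecSq (A i) := rfl

lemma gradV_apply {m n d : ℕ} (R : Matrix (Fin m) (Fin n) ℝ) (α₀ lamex : ℝ) (lamV : Fin n → ℝ)
    (V : Matrix (Fin n) (Fin d) ℝ) (U : Matrix (Fin m) (Fin d) ℝ) (s : Fin d → ℝ) (j : Fin n) :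
    gradV R α₀ lamex lamV V U s j
      = rowHess (fun i => R i j) α₀ lamex (lamV j) U s (V j) - ∑ i, R i j • U i := by
  have hU : Uᵀ * U = ∑ i, vecMulVec (U i) (U i) := by
    ext k l
    simp [Matrix.mul_apply, Matrix.sum_apply, vecMulVec_apply]
  change (_ : Fin d → ℝ) - _ = _
  rw [hU]
  simp only [rowHess, add_mulVec, smul_mulVec, sum_mulVec, vecMulVec_mulVec, one_mulVec,
    op_smul_eq_smul, smul_sum, smul_smul, add_mul, add_smul, sum_add_distrib]

lemma augL_eq_sum_rowLoss {m n d : ℕ} (R : Matrix (Fin m) (Fin n) ℝ)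
    (hR : ∀ i j, R i j = 0 ∨ R i j = 1) (α₀ lamex : ℝ) (lamU : Fin m → ℝ) (lamV : Fin n → ℝ)
    (ρ : ℝ) (V : Matrix (Fin n) (Fin d) ℝ) (U : Matrix (Fin m) (Fin d) ℝ) (s w : Fin d → ℝ) :
    augL R α₀ lamex lamU lamV ρ V U s w
      = ∑ j, rowLoss (fun i => R i j) α₀ lamex (lamV j) U s (V j)
        + ((1/2) * ∑ i, lamU i * vecSq (U i) + (ρ/2) * vecSq (avgRow U - s + w)
          - (ρ/2) * vecSq w) := by
  have hfit : frobSq (hprod R (R - U * Vᵀ)) = ∑ j, ∑ i, R i j * (1 - U i ⬝ᵥ V j) ^ 2 := by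
    rw [frobSq, sum_comm]
    refine sum_congr rfl fun j _ => sum_congr rfl fun i _ => ?_
    have hmul : (U * Vᵀ) i j = U i ⬝ᵥ V j := rfl
    simp only [hprod, of_apply, Matrix.sub_apply, hmul]
    rcases hR i j with h | h <;> simp [h]
  have hdot : frobSq (U * Vᵀ) = ∑ j, ∑ i, (U i ⬝ᵥ V j) ^ 2 := by
    rw [frobSq, sum_comm]
    rfl
  have hex : vecSq (V.mulVec s) = ∑ j, (s ⬝ᵥ V j) ^ 2 :=
    sum_congr rfl fun j _ => by rw [dotProduct_comm]; rfl
  have hreg : (1/2) * ∑ j, lamV j * vecSq (V j) = ∑ j, lamV j / 2 * (V j ⬝ᵥ V j) := by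
    rw [mul_sum]
    exact sum_congr rfl fun j _ => by rw [vecSq_eq_dotProduct]; ring
  simp only [augL, gFun, iALSLoss, rowLoss, hfit, hdot, hex, hreg, sum_add_distrib, ← mul_sum]
  ring

lemma rowHess_dotProduct {m d : ℕ} (r : Fin m → ℝ) (α₀ lamex l : ℝ)
    (U : Matrix (Fin m) (Fin d) ℝ) (s v x : Fin d → ℝ) :
    rowHess r α₀ lamex l U s v ⬝ᵥ x
      = ∑ i, (r i + α₀) * (U i ⬝ᵥ v) * (U i ⬝ᵥ x) + lamex * (s ⬝ᵥ v) * (s ⬝ᵥ x)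
        + l * (v ⬝ᵥ x) := by
  simp [rowHess, add_dotProduct, sum_dotProduct]

lemma rowLoss_add_smul {m d : ℕ} (r : Fin m → ℝ) (α₀ lamex l : ℝ)
    (U : Matrix (Fin m) (Fin d) ℝ) (s v x : Fin d → ℝ) (t : ℝ) :
    rowLoss r α₀ lamex l U s (v + t • x)
      = rowLoss r α₀ lamex l U s v
        + t * ((rowHess r α₀ lamex l U s v - ∑ i, r i • U i) ⬝ᵥ x)
        + t ^ 2 / 2 * (rowHess r α₀ lamex l U s x ⬝ᵥ x) := by
  have hsum : (1/2) * ∑ i, r i * (1 - U i ⬝ᵥ (v + t • x)) ^ 2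
        + (α₀/2) * ∑ i, (U i ⬝ᵥ (v + t • x)) ^ 2
      = (1/2) * ∑ i, r i * (1 - U i ⬝ᵥ v) ^ 2 + (α₀/2) * ∑ i, (U i ⬝ᵥ v) ^ 2
        + t * (∑ i, (r i + α₀) * (U i ⬝ᵥ v) * (U i ⬝ᵥ x) - ∑ i, r i * (U i ⬝ᵥ x))
        + t ^ 2 / 2 * ∑ i, (r i + α₀) * (U i ⬝ᵥ x) * (U i ⬝ᵥ x) := by
    simp only [mul_sum, ← sum_add_distrib, ← sum_sub_distrib]
    refine sum_congr rfl fun i _ => ?_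
    simp only [dotProduct_add, dotProduct_smul, smul_eq_mul]
    ring
  rw [rowLoss, hsum, sub_dotProduct, rowHess_dotProduct, rowHess_dotProduct, rowLoss]
  simp only [dotProduct_add, add_dotProduct, dotProduct_smul, smul_dotProduct, smul_eq_mul,
    sum_dotProduct, dotProduct_comm x v]
  ring

lemma eq_zero_of_forall_quadratic_nonneg {b c : ℝ} (h : ∀ t : ℝ, 0 ≤ t * b + t ^ 2 / 2 * c) :
    b = 0 := by
  have hdisc := discrim_le_zero (a := c / 2) (b := b) (c := 0) fun t => by
    linarith [h t]
  rw [discrim] at hdisc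
  nlinarith [sq_nonneg b]

lemma gradV_eq_zero_of_forall_augL_le {m n d : ℕ} (R : Matrix (Fin m) (Fin n) ℝ)
    (hR : ∀ i j, R i j = 0 ∨ R i j = 1) (α₀ lamex : ℝ) (lamU : Fin m → ℝ) (lamV : Fin n → ℝ)
    (ρ : ℝ) (V : Matrix (Fin n) (Fin d) ℝ) (U : Matrix (Fin m) (Fin d) ℝ) (s w : Fin d → ℝ)
    (hmin : ∀ V', augL R α₀ lamex lamU lamV ρ V U s w ≤ augL R α₀ lamex lamU lamV ρ V' U s w) :
    gradV R α₀ lamex lamV V U s = 0 := by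
  set G := gradV R α₀ lamex lamV V U s with hG
  have hGG : ∑ j, G j ⬝ᵥ G j = 0 := by
    refine eq_zero_of_forall_quadratic_nonneg
      (c := ∑ j, rowHess (fun i => R i j) α₀ lamex (lamV j) U s (G j) ⬝ᵥ G j) fun t => ?_
    have h := hmin (V + t • G)
    have hrow (j : Fin n) : (V + t • G) j = V j + t • G j := rfl
    simp only [augL_eq_sum_rowLoss R hR, hrow, rowLoss_add_smul, ← gradV_apply, ← hG,
      sum_add_distrib, ← mul_sum] at h
    linarith
  have hnonneg (j : Fin n) : 0 ≤ G j ⬝ᵥ G j := by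
    rw [← vecSq_eq_dotProduct]
    exact vecSq_nonneg (G j)
  funext j
  exact dotProduct_self_eq_zero.1
    ((sum_eq_zero_iff_of_nonneg fun j _ => hnonneg j).1 hGG j (mem_univ j))

lemma vecNorm_rowHess_le {m d : ℕ} {r : Fin m → ℝ} (hr₀ : ∀ i, 0 ≤ r i) (hr₁ : ∀ i, r i ≤ 1)
    {α₀ lamex l : ℝ} (hα : 0 ≤ α₀) (hlamex : 0 ≤ lamex) (hl : 0 ≤ l)
    (U : Matrix (Fin m) (Fin d) ℝ) (s v : Fin d → ℝ) :
    vecNorm (rowHess r α₀ lamex l U s v)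
      ≤ ((1 + α₀) * frobSq U + lamex * vecSq s + l) * vecNorm v := by
  have hsq (x : Fin d → ℝ) : vecSq x = ‖WithLp.toLp 2 x‖ ^ 2 := by
    rw [← vecNorm_eq_norm, vecNorm_sq]
  have hrank (c : ℝ) (hc : 0 ≤ c) (x : Fin d → ℝ) :
      ‖WithLp.toLp 2 ((c * (x ⬝ᵥ v)) • x)‖ ≤ c * vecSq x * ‖WithLp.toLp 2 v‖ := by
    have hcs : |x ⬝ᵥ v| ≤ ‖WithLp.toLp 2 x‖ * ‖WithLp.toLp 2 v‖ := by
      have h := abs_real_inner_le_norm (WithLp.toLp 2 v) (WithLp.toLp 2 x)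
      rw [EuclideanSpace.inner_toLp_toLp, star_trivial, mul_comm] at h
      exact h
    rw [WithLp.toLp_smul, norm_smul, norm_mul, Real.norm_of_nonneg hc, Real.norm_eq_abs, hsq]
    calc c * |x ⬝ᵥ v| * ‖WithLp.toLp 2 x‖
        ≤ c * (‖WithLp.toLp 2 x‖ * ‖WithLp.toLp 2 v‖) * ‖WithLp.toLp 2 x‖ := by gcongr
      _ = c * ‖WithLp.toLp 2 x‖ ^ 2 * ‖WithLp.toLp 2 v‖ := by ring
  have hsum : ‖WithLp.toLp 2 (∑ i, ((r i + α₀) * (U i ⬝ᵥ v)) • U i)‖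
      ≤ (1 + α₀) * frobSq U * ‖WithLp.toLp 2 v‖ := by
    rw [WithLp.toLp_sum, frobSq_eq_sum_vecSq, mul_sum, sum_mul]
    refine norm_sum_le_of_le _ fun i _ => (hrank _ (add_nonneg (hr₀ i) hα) _).trans ?_
    have := vecSq_nonneg (U i)
    gcongr
    exact hr₁ i
  rw [vecNorm_eq_norm, vecNorm_eq_norm, rowHess, WithLp.toLp_add, WithLp.toLp_add]
  refine (norm_add₃_le).trans ?_
  have hl' : ‖WithLp.toLp 2 (l • v)‖ = l * ‖WithLp.toLp 2 v‖ := by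
    rw [WithLp.toLp_smul, norm_smul, Real.norm_of_nonneg hl]
  linarith [hrank lamex hlamex s]

lemma rowHess_sub {m d : ℕ} (r : Fin m → ℝ) (α₀ lamex l : ℝ) (U : Matrix (Fin m) (Fin d) ℝ)
    (s v v' : Fin d → ℝ) :
    rowHess r α₀ lamex l U s (v - v')
      = rowHess r α₀ lamex l U s v - rowHess r α₀ lamex l U s v' := by
  simp only [rowHess, dotProduct_sub, mul_sub, sub_smul, smul_sub, sum_sub_distrib]
  abel

lemma frobNorm_le_mul_frobNorm {a b : ℕ} {A B : Matrix (Fin a) (Fin b) ℝ} {c : ℝ} (hc : 0 ≤ c)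
    (h : ∀ i, vecNorm (A i) ≤ c * vecNorm (B i)) : frobNorm A ≤ c * frobNorm B := by
  refine Real.sqrt_le_iff.2 ⟨mul_nonneg hc (Real.sqrt_nonneg _), ?_⟩
  have hB : 0 ≤ frobSq B := sum_nonneg fun i _ => vecSq_nonneg (B i)
  rw [mul_pow, frobNorm, Real.sq_sqrt hB, frobSq_eq_sum_vecSq, frobSq_eq_sum_vecSq, mul_sum]
  refine sum_le_sum fun i _ => ?_
  rw [← vecNorm_sq, ← vecNorm_sq, ← mul_pow]
  exact pow_le_pow_left₀ (Real.sqrt_nonneg _) (h i) 2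

/-- bound on ∇_V L_ρ at the current iterate. -/
theorem gradV_augL_bound {m n d : ℕ} (hm : 1 ≤ m) (hn : 1 ≤ n) (hd : 1 ≤ d)
    (R : Matrix (Fin m) (Fin n) ℝ) (hR : ∀ i j, R i j = 0 ∨ R i j = 1)
    (α₀ lamex ρ : ℝ) (hα : 0 < α₀) (hlamex : 0 < lamex) (hρ0 : 0 < ρ)
    (lamU : Fin m → ℝ) (lamV : Fin n → ℝ)
    (hlamU : ∀ i, 0 < lamU i) (hlamV : ∀ j, 0 < lamV j)
    (lamVbar : ℝ) (hVbar : IsGreatest (Set.range lamV) lamVbar)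
    (CU Cs : ℝ) (hCU : 0 < CU) (hCs : 0 < Cs)
    (Vk Vk1 : Matrix (Fin n) (Fin d) ℝ) (Uk : Matrix (Fin m) (Fin d) ℝ)
    (sk wk : Fin d → ℝ)
    (hUkb : frobSq Uk ≤ CU) (hskb : vecSq sk ≤ Cs)
    (hVmin : ∀ V' : Matrix (Fin n) (Fin d) ℝ,
      augL R α₀ lamex lamU lamV ρ Vk1 Uk sk wk
        ≤ augL R α₀ lamex lamU lamV ρ V' Uk sk wk) :
    frobNorm (gradV R α₀ lamex lamV Vk Uk sk)
      ≤ Real.sqrt n * ((1 + α₀) * CU + lamex * Cs + lamVbar) * frobNorm (Vk1 - Vk) := by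
  have hVbar₀ : 0 ≤ lamVbar := by
    obtain ⟨j, rfl⟩ := hVbar.1
    exact (hlamV j).le
  have hzero := gradV_eq_zero_of_forall_augL_le R hR α₀ lamex lamU lamV ρ Vk1 Uk sk wk hVmin
  have hsymm : frobNorm (Vk1 - Vk) = frobNorm (Vk - Vk1) := by
    simp only [frobNorm, frobSq, Matrix.sub_apply, sub_sq_comm (Vk1 _ _)]
  set c := (1 + α₀) * CU + lamex * Cs + lamVbar with hc
  have hc₀ : 0 ≤ c := by positivity
  have hrow (j : Fin n) :
      vecNorm (gradV R α₀ lamex lamV Vk Uk sk j) ≤ c * vecNorm ((Vk - Vk1) j) := by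
    have hdiff : gradV R α₀ lamex lamV Vk Uk sk j
        = rowHess (fun i => R i j) α₀ lamex (lamV j) Uk sk ((Vk - Vk1) j) := by
      have h₁ := congrFun hzero j
      rw [gradV_apply] at h₁
      rw [gradV_apply, ← sub_eq_zero.1 h₁]
      exact (rowHess_sub ..).symm
    rw [hdiff]
    refine (vecNorm_rowHess_le (fun i => ?_) (fun i => ?_) hα.le hlamex.le (hlamV j).le
      Uk sk _).trans (mul_le_mul_of_nonneg_right ?_ (Real.sqrt_nonneg _))
    · rcases hR i j with h | h <;> simp [h]
    · rcases hR i j with h | h <;> simp [h]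
    · rw [hc]
      gcongr
      exact hVbar.2 ⟨j, rfl⟩
  have hsqrt : 1 ≤ Real.sqrt n := Real.one_le_sqrt.2 (by exact_mod_cast hn)
  calc frobNorm (gradV R α₀ lamex lamV Vk Uk sk)
      ≤ c * frobNorm (Vk1 - Vk) := hsymm ▸ frobNorm_le_mul_frobNorm hc₀ hrow
    _ ≤ Real.sqrt n * c * frobNorm (Vk1 - Vk) :=
      mul_le_mul_of_nonneg_right (le_mul_of_one_le_left hc₀ hsqrt) (Real.sqrt_nonneg _)
end
end
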